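/- (Lemma 6 and Corollary 1) Let a ∈ 𝔓^{p−1}M be admissible, i.e. dx^α( Ξ(dx^{α1}∧…∧dx^{α_{n−p}}∧a) ) = 0 for all α and all α1<…<α_{n−p}, and define the 𝔭-bracket {Hω, a} := −Σ_{α1<…<α_{n−p}} ( ∂/∂x^{α1}∧…∧∂/∂x^{α_{n−p}} ∧ Ξ(dx^{α1}∧…∧dx^{α_{n−p}}∧a) )⌟ d(Hω). If Γ is an n-dimensional submanifold of M which is a graph over X, then for every oriented p-dimensional submanifold D ⊂ Γ, ∫_{D_Γ} {Hω, ^s a}_s = ∫_D {Hω, a}; if moreover Γ is the graph of a solution of the Hamilton equations (∂U/∂x^1∧…∧∂U/∂x^n)⌟Ω = (∂U/∂x^1∧…∧∂U/∂x^n)⌟(dH∧ω), then ∫_D {Hω, a} = ∫_D da. -/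

import Mathlib

open scoped BigOperators
open MeasureTheory

noncomputable section

namespace Pataplectic

/-- A multi-index `μ : Fin d → Fin e` is increasing. -/
def IncP {d e : ℕ} (μ : Fin d → Fin e) : Prop := ∀ a b : Fin d, a < b → μ a < μ b

instance {d e : ℕ} : DecidablePred (@IncP d e) := fun μ => by unfold IncP; infer_instance

variable (n k : ℕ)

/-- Coordinates on `X × Y`, where `X = ℝⁿ` and `Y = ℝᵏ`. -/
abbrev E := Fin (n + k) → ℝ

/-- Increasing multi-indices of length `n`, indexing the coordinates
`p_{μ₁…μₙ}` of a point of `ΛⁿT*(X×Y)` over a point of `X×Y`. -/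
abbrev Idx := {μ : Fin n → Fin (n + k) // IncP μ}

/-- The fiber of `ΛⁿT*(X×Y)`, described by its coordinates `p_{μ₁…μₙ}`. -/
abbrev Psp := Idx n k → ℝ

/-- The pataplectic manifold `M = ΛⁿT*(X×Y)`. -/
abbrev Mfd := E n k × Psp n k

/-- Evaluation `⟨p, z₁ ∧ … ∧ zₙ⟩` of `p ∈ ΛⁿT*_q(X×Y)` on an `n`-tuple of
tangent vectors: `Σ_{μ₁<…<μₙ} p_{μ₁…μₙ} det (z_b^{μ_a})`. -/
def pApply (p : Psp n k) (z : Fin n → E n k) : ℝ :=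
  ∑ μ : Idx n k, p μ * Matrix.det (Matrix.of fun a b => z b (μ.1 a))

/-- A (raw) differential `d`-form on `M`, given by its evaluation on `d`-tuples
of tangent vectors. -/
abbrev Form (d : ℕ) := Mfd n k → (Fin d → Mfd n k) → ℝ

variable {n k}

/-- The exterior derivative of a `d`-form on `M`, via the standard formula
on constant vector fields. -/
def extD {d : ℕ} (ω : Form n k d) : Form n k (d + 1) :=
  fun x v => ∑ i : Fin (d + 1),
    (-1 : ℝ) ^ (i : ℕ) * fderiv ℝ (fun y => ω y (i.removeNth v)) x (v i)

/-- Interior product of a vector field with a `(d+1)`-form. -/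
def iota {d : ℕ} (ξ : Mfd n k → Mfd n k) (ω : Form n k (d + 1)) : Form n k d :=
  fun x v => ω x (Fin.cons (ξ x) v)

/-- A raw form is smooth if its evaluation on any fixed tuple of (constant)
tangent vectors is a smooth function on `M`. -/
def SmoothF {d : ℕ} (ω : Form n k d) : Prop := ∀ v, ContDiff ℝ (⊤ : ℕ∞) (fun x => ω x v)

variable (n k)

/-- The Poincaré–Cartan form `θ = Σ_{μ₁<…<μₙ} p_{μ₁…μₙ} dq^{μ₁}∧…∧dq^{μₙ}`. -/
def theta : Form n k n := fun m v => pApply n k m.2 (fun i => (v i).1)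

/-- The pataplectic form `Ω = dθ`. -/
def Omega : Form n k (n + 1) := extD (theta n k)

/-- The volume form `ω = dx¹∧…∧dxⁿ`, pulled back to `M`. -/
def vol : Form n k n := fun _ v => Matrix.det (Matrix.of fun a b => (v b).1 (Fin.castAdd k a))

/-- Lie bracket of two vector fields on `M`. -/
def lieB {n k : ℕ} (ξ η : Mfd n k → Mfd n k) : Mfd n k → Mfd n k :=
  fun x => fderiv ℝ η x (ξ x) - fderiv ℝ ξ x (η x)


/-- The wedge product `dx^{α₁} ∧ … ∧ dx^{α_m} ∧ a` of coordinate 1-forms of `X`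
with an `l`-form `a` on `M`, via the standard alternation formula. -/
def wedgeDxA {n k : ℕ} (l m : ℕ) (α : Fin m → Fin n)
    (a : Mfd n k → AlternatingMap ℝ (Mfd n k) ℝ (Fin l)) : Form n k (m + l) :=
  fun x v => (((m.factorial * l.factorial : ℕ) : ℝ))⁻¹ *
    ∑ σ : Equiv.Perm (Fin (m + l)),
      ((Equiv.Perm.sign σ : ℤ) : ℝ) *
        Matrix.det (Matrix.of fun (i j : Fin m) =>
          (v (σ (Fin.castAdd l j))).1 (Fin.castAdd k (α i))) *
        a x (fun j : Fin l => v (σ (Fin.natAdd m j)))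

/- Here the dimension of `X` is `n = la + m + 1`, and `a ∈ 𝔓^{p-1}M` with
`p - 1 = la` and `n - p = m` (so `1 ≤ p ≤ n`), and `D ⊆ Γ` is a `p`-dimensional
oriented piece of the graph `Γ`, parametrized over `Δ ⊆ ℝᵖ` through `Γ`'s graph map. -/
variable (la m k : ℕ)

/-- The graph map `U : x ↦ (x, u(x), p(x)) ∈ M`. -/
def graphMap (u : (Fin (la + m + 1) → ℝ) → (Fin k → ℝ))
    (pm : (Fin (la + m + 1) → ℝ) → Psp (la + m + 1) k)
    (x : Fin (la + m + 1) → ℝ) : Mfd (la + m + 1) k :=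
  (Fin.append x (u x), pm x)

/-- The tangent frame `X₁, …, Xₙ` of the graph of `γ`, normalized by
`dx^α(X_β) = δ^α_β`. -/
def frame (γ : (Fin (la + m + 1) → ℝ) → Mfd (la + m + 1) k)
    (x : Fin (la + m + 1) → ℝ) : Fin (la + m + 1) → Mfd (la + m + 1) k :=
  fun α => fderiv ℝ γ x (Pi.single α 1)

/-- The `(n+2)`-form `dH ∧ ω` on `M`. -/
def dHomega (H : Mfd (la + m + 1) k → ℝ) : Form (la + m + 1) k (la + m + 2) :=
  fun y w => ∑ i : Fin (la + m + 2),
    (-1 : ℝ) ^ (i : ℕ) * fderiv ℝ H y (w i) * vol (la + m + 1) k y (i.removeNth w)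

/-- The simplified 𝔭-bracket `{Hω, a}` of an admissible `a ∈ 𝔓^{p-1}M`:
`{Hω, a} = −Σ_{α₁<…<α_{n-p}} (∂/∂x^{α₁}∧…∧∂/∂x^{α_{n-p}}∧Ξ(dx^{α₁}∧…∧dx^{α_{n-p}}∧a))
⌟ d(Hω)`. -/
def pBracketHa (H : Mfd (la + m + 1) k → ℝ)
    (XiA : (Fin m → Fin (la + m + 1)) → Mfd (la + m + 1) k → Mfd (la + m + 1) k) :
    Form (la + m + 1) k (la + 1) :=
  fun x v =>
    - ∑ α : {α : Fin m → Fin (la + m + 1) // IncP α},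
        extD (fun y w => H y * vol (la + m + 1) k y w) x
          (fun j : Fin (la + m + 2) =>
            (Fin.append
              (Fin.snoc
                (fun i : Fin m =>
                  ((Pi.single (Fin.castAdd k (α.1 i)) 1 : E (la + m + 1) k), 0))
                (XiA α.1 x))
              v : Fin (m + 1 + (la + 1)) → Mfd (la + m + 1) k)
              (Fin.cast (by omega) j))

/-- Pointwise exterior derivative of a form with alternating values is alternating. -/
lemma exists_alt_extD {n k d : ℕ} (w : Mfd n k → AlternatingMap ℝ (Mfd n k) ℝ (Fin d))
    (x : Mfd n k) (hw : ∀ v, DifferentiableAt ℝ (fun y => w y v) x) :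
    ∃ F : AlternatingMap ℝ (Mfd n k) ℝ (Fin (d + 1)),
      ∀ v, extD (fun y z => w y z) x v = F v := by
  classical
  let D : Mfd n k →ₗ[ℝ] AlternatingMap ℝ (Mfd n k) ℝ (Fin d) :=
    { toFun := fun z =>
        { toFun := fun v => fderiv ℝ (fun y => w y v) x z
          map_update_add' := by
            intro _ v i a b
            have : (fun y => w y (Function.update v i (a + b)))
              = (fun y => w y (Function.update v i a)) + (fun y => w y (Function.update v i b)) := by
              funext y
              simp only [Pi.add_apply]
              convert (w y).map_update_add v i a b
            rw [this, fderiv_add (hw _) (hw _)]; rfl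
          map_update_smul' := by
            intro _ v i c a
            have : (fun y => w y (Function.update v i (c • a)))
              = c • (fun y => w y (Function.update v i a)) := by
              funext y
              simp only [Pi.smul_apply]
              convert (w y).map_update_smul v i c a
            rw [this, fderiv_const_smul (hw _)]; rfl
          map_eq_zero_of_eq' := by
            intro v i j h hij
            have : (fun y => w y v) = fun _ => 0 := by
              funext y
              exact (w y).map_eq_zero_of_eq v h hij
            simp [this] }
      map_add' := by intro a b; ext v; simp
      map_smul' := by intro a b; ext v; simp }
  refine ⟨AlternatingMap.alternatizeUncurryFin D, fun v => ?_⟩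
  rw [AlternatingMap.alternatizeUncurryFin_apply]
  unfold extD
  refine Finset.sum_congr rfl fun i _ => ?_
  rw [← Int.cast_smul_eq_zsmul ℝ]
  simp [D]

lemma alt_sum_apply {V ι J : Type*} [AddCommGroup V] [Module ℝ V] (S : Finset J)
    (f : J → AlternatingMap ℝ V ℝ ι) (v : ι → V) : (∑ j ∈ S, f j) v = ∑ j ∈ S, f j v := by
  classical
  induction S using Finset.induction_on with
  | empty => simp
  | insert j S hj ih => rw [Finset.sum_insert hj, Finset.sum_insert hj, ← ih]; rfl

lemma alt_smul_apply {V ι : Type*} [AddCommGroup V] [Module ℝ V] (c : ℝ)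
    (f : AlternatingMap ℝ V ℝ ι) (v : ι → V) : (c • f) v = c * f v := rfl

/-- The Poincaré–Cartan form with alternating values. -/
def thetaAlt (n k : ℕ) (x : Mfd n k) : AlternatingMap ℝ (Mfd n k) ℝ (Fin n) :=
  ∑ μ : Idx n k, x.2 μ • (Matrix.detRowAlternating (n := Fin n) (R := ℝ)).compLinearMap
    (LinearMap.pi fun a => (LinearMap.proj (μ.1 a)).comp (LinearMap.fst ℝ (E n k) (Psp n k)))

lemma thetaAlt_apply (n k : ℕ) (x : Mfd n k) (v) : thetaAlt n k x v = theta n k x v := by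
  unfold thetaAlt theta pApply
  simp only [alt_sum_apply, alt_smul_apply]
  refine Finset.sum_congr rfl fun μ _ => ?_
  congr 1
  rw [← Matrix.det_transpose]
  rfl

lemma exists_alt_Omega (n k : ℕ) (x : Mfd n k) :
    ∃ F : AlternatingMap ℝ (Mfd n k) ℝ (Fin (n + 1)), ∀ v, Omega n k x v = F v := by
  have h := exists_alt_extD (thetaAlt n k) x (by
    intro v
    simp only [thetaAlt_apply]
    unfold theta pApply
    fun_prop)
  simp only [thetaAlt_apply] at h
  exact h

/-- Fixing the first arguments of an alternating map. -/
lemma exists_alt_append {V : Type*} [AddCommGroup V] [Module ℝ V] {m q : ℕ}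
    (F : AlternatingMap ℝ V ℝ (Fin (m + q))) (w : Fin m → V) :
    ∃ G : AlternatingMap ℝ V ℝ (Fin q), ∀ T, G T = F (Fin.append w T) := by
  classical
  have key : ∀ (T : Fin q → V) (i : Fin q) (x : V), Fin.append w (Function.update T i x)
      = Function.update (Fin.append w T) (Fin.natAdd m i) x := by
    intro T i x
    funext j
    induction j using Fin.addCases with
    | left j =>
      rw [Function.update_of_ne]
      · simp
      · intro h
        have := congrArg Fin.val h
        have := j.2
        simp at *
        omega
    | right j =>
      by_cases h : j = i
      · subst h; simp
      · rw [Function.update_of_ne]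
        · simp [h]
        · intro h'
          exact h (Fin.natAdd_injective _ _ h')
  refine ⟨{ toFun := fun T => F (Fin.append w T)
            map_update_add' := ?_
            map_update_smul' := ?_
            map_eq_zero_of_eq' := ?_ }, fun T => rfl⟩
  · intro inst T i a b
    obtain rfl : inst = instDecidableEqFin q := Subsingleton.elim _ _
    rw [key, key, key, F.map_update_add]
  · intro inst T i c a
    obtain rfl : inst = instDecidableEqFin q := Subsingleton.elim _ _
    rw [key, key, F.map_update_smul]
  · intro T i j h hij
    refine F.map_eq_zero_of_eq _ (i := Fin.natAdd m i) (j := Fin.natAdd m j) (by simpa using h) ?_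
    intro h'
    exact hij (Fin.natAdd_injective _ _ h')

lemma vol_eq_zero {n k : ℕ} (x : Mfd n k) (v : Fin n → Mfd n k) (j : Fin n)
    (h : ∀ β : Fin n, (v j).1 (Fin.castAdd k β) = 0) : vol n k x v = 0 := by
  unfold vol
  exact Matrix.det_eq_zero_of_column_eq_zero j (fun i => h i)

lemma vol_congr {n k : ℕ} (x y : Mfd n k) (v w : Fin n → Mfd n k)
    (h : ∀ j (β : Fin n), (v j).1 (Fin.castAdd k β) = (w j).1 (Fin.castAdd k β)) :
    vol n k x v = vol n k y w := by
  unfold vol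
  congr 1
  ext a b
  exact h b a

lemma extD_Hvol {la m k : ℕ} (H : Mfd (la + m + 1) k → ℝ) (hH : ContDiff ℝ (⊤ : ℕ∞) H)
    (x : Mfd (la + m + 1) k) (v : Fin (la + m + 2) → Mfd (la + m + 1) k) :
    extD (fun y w => H y * vol (la + m + 1) k y w) x v = dHomega la m k H x v := by
  unfold extD dHomega
  refine Finset.sum_congr rfl fun i _ => ?_
  have : (fun y => H y * vol (la + m + 1) k y (i.removeNth v))
      = fun y => H y * vol (la + m + 1) k x (i.removeNth v) := by
    funext y; rfl
  rw [this, fderiv_mul_const (hH.differentiable (by simp) x)]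
  simp
  ring

lemma dHomega_single {la m k : ℕ} (H : Mfd (la + m + 1) k → ℝ)
    (x : Mfd (la + m + 1) k) (v : Fin (la + m + 2) → Mfd (la + m + 1) k) (i : Fin (la + m + 2))
    (h : ∀ β, (v i).1 (Fin.castAdd k β) = 0) :
    dHomega la m k H x v
      = (-1 : ℝ) ^ (i : ℕ) * fderiv ℝ H x (v i) * vol (la + m + 1) k x (i.removeNth v) := by
  unfold dHomega
  refine Finset.sum_eq_single i ?_ (by simp)
  intro j _ hj
  obtain ⟨z, hz⟩ := Fin.exists_succAbove_eq hj.symm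
  rw [vol_eq_zero x _ z, mul_zero]
  intro β
  simp only [Fin.removeNth, hz]
  exact h β

/-- The bracket integrand reduces to the term with `dH(Ξ)`. -/
lemma dHomega_append {la m k : ℕ} (H : Mfd (la + m + 1) k → ℝ)
    (x : Mfd (la + m + 1) k) (w : Fin m → Mfd (la + m + 1) k) (Ξ : Mfd (la + m + 1) k)
    (T : Fin (la + 1) → Mfd (la + m + 1) k) (hΞ : ∀ β, Ξ.1 (Fin.castAdd k β) = 0)
    (h1 : la + m + 2 = m + 1 + (la + 1)) (h2 : la + m + 1 = m + (la + 1)) :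
    dHomega la m k H x (fun j : Fin (la + m + 2) =>
        (Fin.append (Fin.snoc w Ξ) T : Fin (m + 1 + (la + 1)) → Mfd (la + m + 1) k)
          (Fin.cast h1 j))
      = (-1 : ℝ) ^ m * fderiv ℝ H x Ξ *
          vol (la + m + 1) k x (fun j => Fin.append w T (Fin.cast h2 j)) := by
  have e0 : (Fin.append (Fin.snoc w Ξ) T : Fin (m + 1 + (la + 1)) → Mfd (la + m + 1) k)
      (Fin.cast h1 (⟨m, by omega⟩ : Fin (la + m + 2))) = Ξ := by
    have : (Fin.cast h1 (⟨m, by omega⟩ : Fin (la + m + 2))) = Fin.castAdd (la + 1) (Fin.last m) := by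
      ext; simp
    rw [this, Fin.append_left]; simp
  rw [dHomega_single H x _ ⟨m, by omega⟩ (by intro β; rw [e0]; exact hΞ β)]
  simp only [e0]
  congr 2
  funext j
  obtain ⟨j, rfl⟩ : ∃ j', j = Fin.cast h2.symm j' := ⟨Fin.cast h2 j, by simp⟩
  simp only [Fin.removeNth]
  induction j using Fin.addCases with
  | left j =>
    have : (Fin.cast h1 ((⟨m, by omega⟩ : Fin (la + m + 2)).succAbove
        (Fin.cast h2.symm (Fin.castAdd (la + 1) j)))) = Fin.castAdd (la + 1) (Fin.castSucc j) := by
      ext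
      rw [Fin.succAbove_of_castSucc_lt]
      · simp
      · simp [Fin.lt_def]
    rw [this]
    simp
  | right j =>
    have : (Fin.cast h1 ((⟨m, by omega⟩ : Fin (la + m + 2)).succAbove
        (Fin.cast h2.symm (Fin.natAdd m j)))) = Fin.natAdd (m + 1) j := by
      ext
      rw [Fin.succAbove_of_le_castSucc]
      · simp; omega
      · simp [Fin.le_def]
    rw [this]
    simp

lemma wedge_zero {n k : ℕ} (l m : ℕ) (α : Fin m → Fin n)
    (a : Mfd n k → AlternatingMap ℝ (Mfd n k) ℝ (Fin l)) (x : Mfd n k)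
    (v : Fin (m + l) → Mfd n k) (i : Fin m) (h : ∀ j, (v j).1 (Fin.castAdd k (α i)) = 0) :
    wedgeDxA l m α a x v = 0 := by
  unfold wedgeDxA
  rw [Finset.sum_eq_zero, mul_zero]
  intro σ _
  rw [Matrix.det_eq_zero_of_row_eq_zero i (fun j => h _)]
  simp

lemma wedge_append {n k : ℕ} (l m : ℕ) (α : Fin m → Fin n)
    (a : Mfd n k → AlternatingMap ℝ (Mfd n k) ℝ (Fin l)) (x : Mfd n k)
    (w : Fin m → Mfd n k) (s : Fin l → Mfd n k)
    (hw : ∀ i j, (w j).1 (Fin.castAdd k (α i)) = if i = j then 1 else 0)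
    (hs : ∀ i j, (s j).1 (Fin.castAdd k (α i)) = 0) :
    wedgeDxA l m α a x (Fin.append w s) = a x s := by
  classical
  unfold wedgeDxA
  set g : Equiv.Perm (Fin (m + l)) → ℝ := fun σ => ((Equiv.Perm.sign σ : ℤ) : ℝ) *
        Matrix.det (Matrix.of fun (i j : Fin m) =>
          (Fin.append w s (σ (Fin.castAdd l j))).1 (Fin.castAdd k (α i))) *
        a x (fun j : Fin l => Fin.append w s (σ (Fin.natAdd m j))) with hg
  let e : Equiv.Perm (Fin m ⊕ Fin l) ≃ Equiv.Perm (Fin (m + l)) := finSumFinEquiv.permCongr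
  have hinj : Function.Injective (fun τ : Equiv.Perm (Fin m) × Equiv.Perm (Fin l) =>
      e (Equiv.Perm.sumCongrHom _ _ τ)) :=
    e.injective.comp Equiv.Perm.sumCongrHom_injective
  have hval : ∀ τ : Equiv.Perm (Fin m) × Equiv.Perm (Fin l),
      g (e (Equiv.Perm.sumCongrHom _ _ τ)) = a x s := by
    rintro ⟨τ1, τ2⟩
    have hl : ∀ j, e (Equiv.Perm.sumCongrHom _ _ (τ1, τ2)) (Fin.castAdd l j)
        = Fin.castAdd l (τ1 j) := by
      intro j; simp [e, Equiv.permCongr_apply]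
    have hr : ∀ j, e (Equiv.Perm.sumCongrHom _ _ (τ1, τ2)) (Fin.natAdd m j)
        = Fin.natAdd m (τ2 j) := by
      intro j; simp [e, Equiv.permCongr_apply]
    have hsg : Equiv.Perm.sign (e (Equiv.Perm.sumCongrHom _ _ (τ1, τ2)))
        = Equiv.Perm.sign τ1 * Equiv.Perm.sign τ2 := by
      simp only [e, Equiv.Perm.sign_permCongr, Equiv.Perm.sumCongrHom_apply]
      exact Equiv.Perm.sign_sumCongr _ _
    have hdet : Matrix.det (Matrix.of fun (i j : Fin m) =>
        (w (τ1 j)).1 (Fin.castAdd k (α i))) = ((Equiv.Perm.sign τ1 : ℤ) : ℝ) := by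
      have := Matrix.det_permute' τ1 (1 : Matrix (Fin m) (Fin m) ℝ)
      rw [Matrix.det_one, mul_one] at this
      rw [← this]
      congr 1
      ext i j
      simp [hw, Matrix.one_apply]
    have ha : a x (fun j => s (τ2 j)) = ((Equiv.Perm.sign τ2 : ℤ) : ℝ) * a x s := by
      have := (a x).map_perm s τ2
      rw [Units.smul_def, ← Int.cast_smul_eq_zsmul ℝ, smul_eq_mul] at this
      exact this
    simp only [hg, hl, hr, hsg, Fin.append_left, Fin.append_right, hdet, ha]
    rcases Int.units_eq_one_or (Equiv.Perm.sign τ1) with h1 | h1 <;>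
    rcases Int.units_eq_one_or (Equiv.Perm.sign τ2) with h2 | h2 <;> simp [h1, h2]
  have hzero : ∀ σ, σ ∉ Set.range (fun τ : Equiv.Perm (Fin m) × Equiv.Perm (Fin l) =>
      e (Equiv.Perm.sumCongrHom _ _ τ)) → g σ = 0 := by
    intro σ hσ
    have : ∃ j, ∃ j', σ (Fin.castAdd l j) = Fin.natAdd m j' := by
      by_contra hcon
      push Not at hcon
      apply hσ
      have := Equiv.Perm.mem_sumCongrHom_range_of_perm_mapsTo_inl (σ := e.symm σ) (by
        rintro _ ⟨j, rfl⟩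
        rcases hh : e.symm σ (Sum.inl j) with z | z
        · exact ⟨z, rfl⟩
        · exfalso
          apply hcon j z
          have := congrArg finSumFinEquiv hh
          simpa [e, Equiv.permCongr_symm, Equiv.permCongr_apply] using this)
      obtain ⟨τ, hτ⟩ := this
      refine ⟨τ, ?_⟩
      simp only [hτ, Equiv.apply_symm_apply]
    obtain ⟨j, j', hj⟩ := this
    simp only [hg]
    rw [Matrix.det_eq_zero_of_column_eq_zero j]
    · simp
    · intro i
      simp [hj, hs]
  have hsum : ∑ σ, g σ = ∑ τ : Equiv.Perm (Fin m) × Equiv.Perm (Fin l), a x s := by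
    symm
    refine Fintype.sum_of_injective _ hinj _ _ ?_ ?_
    · intro σ hσ; exact hzero σ hσ
    · intro τ; exact (hval τ).symm
  rw [hsum]
  simp only [Finset.sum_const, Finset.card_univ, Fintype.card_prod, Fintype.card_perm,
    Fintype.card_fin, nsmul_eq_mul]
  have : ((m.factorial * l.factorial : ℕ) : ℝ) ≠ 0 := by
    exact_mod_cast (Nat.mul_pos m.factorial_pos l.factorial_pos).ne'
  field_simp

lemma extD_wedge_append {n k : ℕ} (l m : ℕ) (α : Fin m → Fin n)
    (a : Mfd n k → AlternatingMap ℝ (Mfd n k) ℝ (Fin l)) (x : Mfd n k)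
    (w : Fin m → Mfd n k) (s : Fin (l + 1) → Mfd n k)
    (hw : ∀ i j, (w j).1 (Fin.castAdd k (α i)) = if i = j then 1 else 0)
    (hs : ∀ i j, (s j).1 (Fin.castAdd k (α i)) = 0) :
    extD (wedgeDxA l m α a) x (Fin.append w s : Fin (m + (l + 1)) → Mfd n k)
      = (-1 : ℝ) ^ m * extD (fun y z => a y z) x s := by
  unfold extD
  refine (Fin.sum_univ_add (a := m) (b := l + 1) _).trans ?_
  rw [Finset.sum_eq_zero, zero_add, Finset.mul_sum]
  · refine Finset.sum_congr rfl fun j _ => ?_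
    have hrem : (Fin.removeNth (Fin.natAdd m j : Fin (m + l + 1)) (Fin.append w s :
        Fin (m + (l + 1)) → Mfd n k)) = Fin.append w (j.removeNth s) := by
      funext z
      simp only [Fin.removeNth]
      induction z using Fin.addCases with
      | left z =>
        have : (Fin.natAdd m j : Fin (m + l + 1)).succAbove (Fin.castAdd l z)
            = Fin.castAdd (l + 1) z := by
          ext
          rw [Fin.succAbove_of_castSucc_lt]
          · simp
          · have := z.2
            simp [Fin.lt_def]; omega
        rw [this]; simp
      | right z =>
        have : (Fin.natAdd m j : Fin (m + l + 1)).succAbove (Fin.natAdd m z)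
            = Fin.natAdd m (j.succAbove z) := by
          ext
          simp only [Fin.succAbove, Fin.lt_def, Fin.val_natAdd, Fin.val_castSucc]
          split_ifs <;> simp_all <;> omega
        rw [this]; simp [Fin.removeNth]
    simp only [hrem]
    have : (fun y => wedgeDxA l m α a y (Fin.append w (j.removeNth s)))
        = fun y => a y (j.removeNth s) := by
      funext y
      exact wedge_append l m α a y w _ hw (fun i z => hs i _)
    rw [this]
    simp only [Fin.append_right, Fin.val_natAdd, pow_add]
    ring
  · intro i _
    have : (fun y => wedgeDxA l m α a y (Fin.removeNth (Fin.castAdd (l + 1) i : Fin (m + l + 1))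
        (Fin.append w s : Fin (m + (l + 1)) → Mfd n k))) = fun _ => 0 := by
      funext y
      refine wedge_zero l m α a y _ i ?_
      intro j
      simp only [Fin.removeNth]
      have hne := Fin.succAbove_ne (Fin.castAdd (l + 1) i : Fin (m + l + 1)) j
      generalize (Fin.castAdd (l + 1) i : Fin (m + l + 1)).succAbove j = z at hne
      change Fin (m + (l + 1)) at z
      induction z using Fin.addCases with
      | left z =>
        rw [Fin.append_left, hw, if_neg]
        rintro rfl
        exact hne rfl
      | right z => rw [Fin.append_right, hs]
    rw [this]
    simp

lemma Omega_cons_snoc {n k : ℕ} {F : AlternatingMap ℝ (Mfd n k) ℝ (Fin (n + 1))}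
    (X : Fin n → Mfd n k) (V : Mfd n k) :
    F (Fin.snoc X V) = (-1 : ℝ) ^ n * F (Fin.cons V X) := by
  rw [Fin.snoc_eq_cons_rotate]
  have := F.map_perm (Fin.cons V X) (finRotate (n + 1))
  rw [Units.smul_def, ← Int.cast_smul_eq_zsmul ℝ, smul_eq_mul, sign_finRotate] at this
  simpa [Function.comp_def] using this

lemma vol_lin {n k : ℕ} (x : Mfd n k) (Lm : (Fin n → ℝ) →ₗ[ℝ] Mfd n k)
    (hL : ∀ v (β : Fin n), (Lm v).1 (Fin.castAdd k β) = v β)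
    (G : AlternatingMap ℝ (Mfd n k) ℝ (Fin n)) (τ : Fin n → Fin n → ℝ) :
    G (fun j => Lm (τ j)) = vol n k x (fun j => Lm (τ j)) *
      G (fun β => Lm (Pi.single β 1)) := by
  have h := (G.compLinearMap Lm).eq_smul_basis_det (Pi.basisFun ℝ (Fin n))
  have h2 := congrArg (fun f : AlternatingMap ℝ (Fin n → ℝ) ℝ (Fin n) => f τ) h
  simp only [Pi.basisFun_det] at h2
  have h3 : vol n k x (fun j => Lm (τ j)) = Matrix.detRowAlternating τ := by
    unfold vol
    simp only [hL]
    rw [← Matrix.det_transpose]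
    rfl
  rw [h3, mul_comm]
  have h4 : (⇑Lm ∘ ⇑(Pi.basisFun ℝ (Fin n))) = fun β => Lm (Pi.single β 1) := by
    funext β; simp
  simpa [AlternatingMap.compLinearMap_apply, Function.comp_def, h4] using h2

/-- The unique complementary increasing multi-index. -/
lemma exists_compl {la m : ℕ} (β : Fin (la + 1) → Fin (la + m + 1)) (hβ : Function.Injective β) :
    ∃ α : Fin m → Fin (la + m + 1), IncP α ∧ (∀ i j, α i ≠ β j) ∧
      ∀ α' : Fin m → Fin (la + m + 1), IncP α' → (∀ i j, α' i ≠ β j) → α' = α := by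
  classical
  have hc : ((Finset.univ.image β)ᶜ).card = m := by
    rw [Finset.card_compl, Finset.card_image_of_injective _ hβ]
    simp
  refine ⟨Finset.orderEmbOfFin _ hc, ?_, ?_, ?_⟩
  · intro a b hab
    exact (Finset.orderEmbOfFin _ hc).strictMono hab
  · intro i j h
    have := Finset.orderEmbOfFin_mem _ hc i
    rw [h] at this
    simp at this
  · intro α' h1 h2
    refine Finset.orderEmbOfFin_unique hc ?_ (fun a b hab => h1 a b hab)
    intro i
    simp only [Finset.mem_compl, Finset.mem_image, not_exists]
    rintro j ⟨_, hj⟩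
    exact h2 i j hj.symm

lemma core {la m k : ℕ}
    (H : Mfd (la + m + 1) k → ℝ) (hH : ContDiff ℝ (⊤ : ℕ∞) H)
    (a : Mfd (la + m + 1) k → AlternatingMap ℝ (Mfd (la + m + 1) k) ℝ (Fin la))
    (ha : ∀ v, ContDiff ℝ (⊤ : ℕ∞) (fun x => a x v))
    (XiA : (Fin m → Fin (la + m + 1)) → Mfd (la + m + 1) k → Mfd (la + m + 1) k)
    (Q : Mfd (la + m + 1) k) (h3 : m + la + 1 = la + m + 1)
    (hXiA : ∀ α : Fin m → Fin (la + m + 1), IncP α →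
      ∀ (v : Fin (la + m + 1) → Mfd (la + m + 1) k),
        extD (wedgeDxA la m α a) Q (fun j => v (Fin.cast h3 j))
          = - iota (XiA α) (Omega (la + m + 1) k) Q v)
    (hadm : ∀ α : Fin m → Fin (la + m + 1), IncP α →
      ∀ (β : Fin (la + m + 1)), (XiA α Q).1 (Fin.castAdd k β) = 0)
    (Lm : (Fin (la + m + 1) → ℝ) →ₗ[ℝ] Mfd (la + m + 1) k)
    (hL : ∀ v (β : Fin (la + m + 1)), (Lm v).1 (Fin.castAdd k β) = v β)
    (hHam : ∀ V : Mfd (la + m + 1) k,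
        Omega (la + m + 1) k Q (Fin.snoc (fun β => Lm (Pi.single β 1)) V)
          = dHomega la m k H Q (Fin.snoc (fun β => Lm (Pi.single β 1)) V))
    (τ : Fin (la + 1) → Fin (la + m + 1) → ℝ) :
    pBracketHa la m k H XiA Q (fun j => Lm (τ j))
      = extD (fun y w => a y w) Q (fun j => Lm (τ j)) := by
  classical
  obtain ⟨F, hF⟩ := exists_alt_Omega (la + m + 1) k Q
  set X : Fin (la + m + 1) → Mfd (la + m + 1) k := fun β => Lm (Pi.single β 1) with hX
  have h2 : la + m + 1 = m + (la + 1) := by omega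
  have hvolX : vol (la + m + 1) k Q X = 1 := by
    unfold vol
    have : (Matrix.of fun a b => (X b).1 (Fin.castAdd k a))
        = (1 : Matrix (Fin (la + m + 1)) (Fin (la + m + 1)) ℝ) := by
      ext i j
      simp [hX, hL, Matrix.one_apply, Pi.single_apply]
    rw [this, Matrix.det_one]
  -- the Hamilton equations contracted with Ξ
  have step1 : ∀ α : Fin m → Fin (la + m + 1), IncP α →
      F (Fin.cons (XiA α Q) X) = fderiv ℝ H Q (XiA α Q) := by
    intro α hα
    have e := hHam (XiA α Q)
    rw [hF, Omega_cons_snoc, dHomega_single H Q _ (Fin.last _)] at e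
    · have hr : Fin.removeNth (Fin.last (la + m + 1)) (Fin.snoc X (XiA α Q) :
          Fin (la + m + 2) → Mfd (la + m + 1) k) = X := by
        funext j
        simp [Fin.removeNth]
      rw [hr, hvolX, Fin.snoc_last, Fin.val_last, mul_one] at e
      exact mul_left_cancel₀ (pow_ne_zero _ (by norm_num)) e
    · intro β
      rw [Fin.snoc_last]
      exact hadm α hα β
  -- wedge in terms of F
  have step2 : ∀ α : Fin m → Fin (la + m + 1), IncP α → ∀ w : Fin (m + (la + 1)) →
      Mfd (la + m + 1) k, extD (wedgeDxA la m α a) Q w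
        = - F (Fin.cons (XiA α Q) (fun j => w (Fin.cast h2 j))) := by
    intro α hα w
    have e := hXiA α hα (fun j => w (Fin.cast h2 j))
    rw [iota, hF] at e
    exact e
  have step3 : ∀ σ : Fin (la + 1) → Fin (la + m + 1) → ℝ,
      pBracketHa la m k H XiA Q (fun j => Lm (σ j))
      = ∑ α : {α : Fin m → Fin (la + m + 1) // IncP α},
          (-1 : ℝ) ^ m * extD (wedgeDxA la m α.1 a) Q
            (Fin.append (fun i => X (α.1 i)) (fun j => Lm (σ j)) :
              Fin (m + (la + 1)) → Mfd (la + m + 1) k) := by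
    intro σ
    unfold pBracketHa
    rw [← Finset.sum_neg_distrib]
    refine Finset.sum_congr rfl fun α _ => ?_
    rw [extD_Hvol H hH, dHomega_append H Q _ _ _ (hadm α.1 α.2) _ h2, step2 α.1 α.2,
      ← step1 α.1 α.2]
    let ρ : Fin (la + m + 1) → Fin (la + m + 1) → ℝ := fun j =>
      (Fin.append (fun i => Pi.single (α.1 i) 1) σ : Fin (m + (la + 1)) → _) (Fin.cast h2 j)
    have hρ : (fun j => (Fin.append (fun i => X (α.1 i)) (fun j => Lm (σ j)) :
        Fin (m + (la + 1)) → Mfd (la + m + 1) k) (Fin.cast h2 j)) = fun j => Lm (ρ j) := by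
      funext j
      simp only [ρ]
      generalize Fin.cast h2 j = z
      induction z using Fin.addCases <;> simp [hX]
    have hv : vol (la + m + 1) k Q (fun j => (Fin.append (fun i : Fin m =>
          (((Pi.single (Fin.castAdd k (α.1 i)) 1 : E (la + m + 1) k), 0) : Mfd (la + m + 1) k))
          (fun j => Lm (σ j)) : Fin (m + (la + 1)) → Mfd (la + m + 1) k) (Fin.cast h2 j))
        = vol (la + m + 1) k Q (fun j => Lm (ρ j)) := by
      refine vol_congr _ _ _ _ ?_
      intro j β
      rw [hL]
      simp only [ρ]
      generalize Fin.cast h2 j = z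
      induction z using Fin.addCases with
      | left z => simp [Pi.single_apply, Fin.ext_iff]
      | right z => simp [hL]
    have hG := vol_lin Q Lm hL (F.curryLeft (XiA α.1 Q)) ρ
    have hG' : F (Fin.cons (XiA α.1 Q) (fun j => Lm (ρ j)))
      = vol (la + m + 1) k Q (fun j => Lm (ρ j)) * F (Fin.cons (XiA α.1 Q) X) := hG
    rw [hρ, hv, hG']
    ring
  rw [step3]
  -- both sides are alternating in τ
  obtain ⟨A, hA⟩ := exists_alt_extD a Q (fun v => (ha v).differentiable (by simp) Q)
  have hB : ∀ α : {α : Fin m → Fin (la + m + 1) // IncP α},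
      ∃ B : AlternatingMap ℝ (Mfd (la + m + 1) k) ℝ (Fin (la + 1)), ∀ T,
        B T = extD (wedgeDxA la m α.1 a) Q
            (Fin.append (fun i => X (α.1 i)) T :
              Fin (m + (la + 1)) → Mfd (la + m + 1) k) := by
    intro α
    obtain ⟨B, hB⟩ := exists_alt_append
      ((F.curryLeft (XiA α.1 Q)).domDomCongr (finCongr h2)) (fun i => X (α.1 i))
    refine ⟨-B, fun T => ?_⟩
    rw [step2 α.1 α.2, AlternatingMap.neg_apply, hB]
    rfl
  choose B hB using hB
  have hmain : (∑ α, (-1 : ℝ) ^ m • (B α).compLinearMap Lm) = A.compLinearMap Lm := by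
    refine Module.Basis.ext_alternating (Pi.basisFun ℝ (Fin (la + m + 1))) ?_
    intro β hβ
    simp only [alt_sum_apply, alt_smul_apply, AlternatingMap.compLinearMap_apply,
      Pi.basisFun_apply]
    rw [← hA]
    obtain ⟨α, hα, hd, hu⟩ := exists_compl β hβ
    rw [Finset.sum_eq_single (⟨α, hα⟩ : {α : Fin m → Fin (la + m + 1) // IncP α})]
    · rw [hB]
      have hαi : Function.Injective α := by
        intro i j hij
        rcases lt_trichotomy i j with h | h | h
        · exact absurd hij (hα _ _ h).ne
        · exact h
        · exact absurd hij (hα _ _ h).ne'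
      have := extD_wedge_append la m α a Q (fun i => X (α i))
        (fun j => Lm (Pi.single (β j) 1)) (by
          intro i j
          simp [hX, hL, Pi.single_apply, hαi.eq_iff]) (by
          intro i j
          simp [hL, Pi.single_apply, hd])
      have e : ((-1 : ℝ) ^ m) * (-1) ^ m = 1 := by
        rw [← mul_pow]; simp
      simp only [Function.comp_def]
      refine (congrArg _ this).trans ?_
      rw [← mul_assoc, e, one_mul]
    · intro α' _ hne
      have : ∃ i j, α'.1 i = β j := by
        by_contra hcon
        push Not at hcon
        exact hne (Subtype.ext (hu α'.1 α'.2 hcon))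
      obtain ⟨i, j, hij⟩ := this
      rw [hB, step2 α'.1 α'.2]
      refine mul_eq_zero_of_right _ (neg_eq_zero.mpr ?_)
      refine F.map_eq_zero_of_eq _
        (i := Fin.succ (Fin.cast h2.symm (Fin.castAdd (la + 1) i)))
        (j := Fin.succ (Fin.cast h2.symm (Fin.natAdd m j))) ?_ ?_
      · simp [hX, hij]
      · intro h
        have := congrArg Fin.val h
        have := i.2
        simp at *
        omega
    · simp
  have := congrArg (fun f : AlternatingMap ℝ (Fin (la + m + 1) → ℝ) ℝ (Fin (la + 1)) => f τ) hmain
  simp only [alt_sum_apply, alt_smul_apply,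
    AlternatingMap.compLinearMap_apply] at this
  rw [hA]
  simp only [hB] at this
  exact this

lemma graphMap_contDiff {la m k : ℕ}
    (u : (Fin (la + m + 1) → ℝ) → (Fin k → ℝ)) (hu : ContDiff ℝ (⊤ : ℕ∞) u)
    (pm : (Fin (la + m + 1) → ℝ) → Psp (la + m + 1) k) (hpm : ContDiff ℝ (⊤ : ℕ∞) pm) :
    ContDiff ℝ (⊤ : ℕ∞) (graphMap la m k u pm) := by
  unfold graphMap
  refine ContDiff.prodMk ?_ hpm
  rw [contDiff_pi]
  intro i
  induction i using Fin.addCases with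
  | left i => simp only [Fin.append_left]; fun_prop
  | right i => simp only [Fin.append_right]; fun_prop

lemma graphMap_fderiv {la m k : ℕ}
    (u : (Fin (la + m + 1) → ℝ) → (Fin k → ℝ)) (hu : ContDiff ℝ (⊤ : ℕ∞) u)
    (pm : (Fin (la + m + 1) → ℝ) → Psp (la + m + 1) k) (hpm : ContDiff ℝ (⊤ : ℕ∞) pm)
    (x v : Fin (la + m + 1) → ℝ) (β : Fin (la + m + 1)) :
    (fderiv ℝ (graphMap la m k u pm) x v).1 (Fin.castAdd k β) = v β := by
  have hd : DifferentiableAt ℝ (graphMap la m k u pm) x :=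
    (graphMap_contDiff u hu pm hpm).differentiable (by simp) x
  let P : Mfd (la + m + 1) k →L[ℝ] ℝ :=
    (ContinuousLinearMap.proj (Fin.castAdd k β)).comp
      (ContinuousLinearMap.fst ℝ (E (la + m + 1) k) (Psp (la + m + 1) k))
  have h1 : HasFDerivAt (fun y => P (graphMap la m k u pm y))
      (P.comp (fderiv ℝ (graphMap la m k u pm) x)) x := P.hasFDerivAt.comp x hd.hasFDerivAt
  have h2 : (fun y => P (graphMap la m k u pm y)) =
      (ContinuousLinearMap.proj β : (Fin (la + m + 1) → ℝ) →L[ℝ] ℝ) := by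
    funext y
    simp [P, graphMap]
  rw [h2] at h1
  have := h1.unique (ContinuousLinearMap.hasFDerivAt _)
  exact congrArg (fun f : (Fin (la + m + 1) → ℝ) →L[ℝ] ℝ => f v) this

/-- (Lemma 6 and Corollary 1.) Let `a ∈ 𝔓^{p-1}M` be admissible, i.e.
`dx^α(Ξ(dx^{α₁}∧…∧dx^{α_{n-p}}∧a)) = 0` for all `α` and all `α₁<…<α_{n-p}`.
If `Γ` is an `n`-dimensional submanifold of `M` which is a graph over `X`, then for
every oriented `p`-dimensional piece `D ⊆ Γ`, `∫_{D_Γ} {Hω, ˢa}_s = ∫_D {Hω, a}`;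
if moreover `Γ` is the graph of a solution of the Hamilton equations, then
`∫_D {Hω, a} = ∫_D da`. -/
theorem admissible_bracket_integrals
    (la m k : ℕ)
    (H : Mfd (la + m + 1) k → ℝ) (hH : ContDiff ℝ (⊤ : ℕ∞) H)
    (u : (Fin (la + m + 1) → ℝ) → (Fin k → ℝ)) (hu : ContDiff ℝ (⊤ : ℕ∞) u)
    (pm : (Fin (la + m + 1) → ℝ) → Psp (la + m + 1) k) (hpm : ContDiff ℝ (⊤ : ℕ∞) pm)
    (a : Mfd (la + m + 1) k → AlternatingMap ℝ (Mfd (la + m + 1) k) ℝ (Fin la))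
    (ha : ∀ v, ContDiff ℝ (⊤ : ℕ∞) (fun x => a x v))
    (XiA : (Fin m → Fin (la + m + 1)) → Mfd (la + m + 1) k → Mfd (la + m + 1) k)
    (hXiA : ∀ α : Fin m → Fin (la + m + 1), IncP α →
      ∀ (x : Mfd (la + m + 1) k) (v : Fin (la + m + 1) → Mfd (la + m + 1) k),
        extD (wedgeDxA la m α a) x (fun j => v (Fin.cast (by omega) j))
          = - iota (XiA α) (Omega (la + m + 1) k) x v)
    -- admissibility of `a`:
    (hadm : ∀ α : Fin m → Fin (la + m + 1), IncP α →
      ∀ (x : Mfd (la + m + 1) k) (β : Fin (la + m + 1)),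
        (XiA α x).1 (Fin.castAdd k β) = 0)
    -- the `p`-dimensional piece `D ⊆ Γ`, parametrized over `Δ`:
    (Δ : Set (Fin (la + 1) → ℝ)) (hΔ : MeasurableSet Δ)
    (hΔb : Bornology.IsBounded Δ)
    (xmap : (Fin (la + 1) → ℝ) → (Fin (la + m + 1) → ℝ)) (hx : ContDiff ℝ (⊤ : ℕ∞) xmap) :
    -- Lemma 6: `∫_{D_Γ} {Hω, ˢa}_s = ∫_D {Hω, a}` for any graph `Γ`:
    ((∫ t in Δ,
        - ∑ α : {α : Fin m → Fin (la + m + 1) // IncP α},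
            extD (fun y w => H y * vol (la + m + 1) k y w)
              (graphMap la m k u pm (xmap t))
              (fun j : Fin (la + m + 2) =>
                (Fin.append
                  (Fin.snoc
                    (fun i : Fin m =>
                      frame la m k (graphMap la m k u pm) (xmap t) (α.1 i))
                    (XiA α.1 (graphMap la m k u pm (xmap t))))
                  (fun j' : Fin (la + 1) =>
                    fderiv ℝ (fun s => graphMap la m k u pm (xmap s)) t
                      (Pi.single j' 1)) : Fin (m + 1 + (la + 1)) → Mfd (la + m + 1) k)
                  (Fin.cast (by omega) j)))
      = ∫ t in Δ,
          pBracketHa la m k H XiA (graphMap la m k u pm (xmap t))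
            (fun j : Fin (la + 1) =>
              fderiv ℝ (fun s => graphMap la m k u pm (xmap s)) t (Pi.single j 1)))
    ∧
    -- Corollary 1: if moreover the Hamilton equations hold, `∫_D {Hω,a} = ∫_D da`:
    ((∀ (x : Fin (la + m + 1) → ℝ) (V : Mfd (la + m + 1) k),
        Omega (la + m + 1) k (graphMap la m k u pm x)
            (Fin.snoc (frame la m k (graphMap la m k u pm) x) V)
          = dHomega la m k H (graphMap la m k u pm x)
              (Fin.snoc (frame la m k (graphMap la m k u pm) x) V)) →
      (∫ t in Δ,
          pBracketHa la m k H XiA (graphMap la m k u pm (xmap t))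
            (fun j : Fin (la + 1) =>
              fderiv ℝ (fun s => graphMap la m k u pm (xmap s)) t (Pi.single j 1)))
        = ∫ t in Δ,
            extD (fun y w => a y w) (graphMap la m k u pm (xmap t))
              (fun j : Fin (la + 1) =>
                fderiv ℝ (fun s => graphMap la m k u pm (xmap s)) t
                  (Pi.single j 1))) := by
  have hg := graphMap_contDiff u hu pm hpm
  refine ⟨?_, ?_⟩
  · refine setIntegral_congr_fun hΔ (fun t _ => ?_)
    beta_reduce
    unfold pBracketHa
    congr 1
    refine Finset.sum_congr rfl fun α _ => ?_
    have h2 : la + m + 1 = m + (la + 1) := by omega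
    rw [extD_Hvol H hH, extD_Hvol H hH, dHomega_append H _ _ _ _ (hadm α.1 α.2 _) _ h2,
      dHomega_append H _ _ _ _ (hadm α.1 α.2 _) _ h2]
    congr 1
    refine vol_congr _ _ _ _ ?_
    intro j β
    generalize Fin.cast h2 j = z
    induction z using Fin.addCases with
    | left z =>
      rw [Fin.append_left, Fin.append_left, frame, graphMap_fderiv u hu pm hpm]
      simp [Pi.single_apply, Fin.ext_iff]
    | right z => simp
  · intro hHam
    refine setIntegral_congr_fun hΔ (fun t _ => ?_)
    beta_reduce
    have hT : ∀ j : Fin (la + 1), fderiv ℝ (fun s => graphMap la m k u pm (xmap s)) t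
        (Pi.single j 1) = (fderiv ℝ (graphMap la m k u pm) (xmap t)).toLinearMap
          (fderiv ℝ xmap t (Pi.single j 1)) := by
      intro j
      have := fderiv_comp t (hg.differentiable (by simp) (xmap t))
        (hx.differentiable (by simp) t)
      exact congrArg (fun f : (Fin (la + 1) → ℝ) →L[ℝ] Mfd (la + m + 1) k =>
        f (Pi.single j 1)) this
    simp only [hT]
    exact core H hH a ha XiA _ (by omega) (fun α hα v => hXiA α hα _ v) (fun α hα β => hadm α hα _ β) _
      (fun v β => graphMap_fderiv u hu pm hpm _ v β) (fun V => hHam (xmap t) V) _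

end Pataplectic

end
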